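/- There exists N such that for every n ≥ N and every real p with 3·(log₂ n)²/n ≤ p ≤ 1 − 3·(log₂ n)²/n, the probability under μ_{n,p} that the random graph G_ω has functionality fun(G_ω) > (1/2)·log₂ n is at least 1 − n^{−log₂ n}. -/

import Mathlib

open Classical in
/-- `v` is a function of the set `U` of vertices in the graph `G`. -/
def SimpleGraph.IsFunctionOf {V : Type*} (G : SimpleGraph V) (v : V)
    (U : Finset V) : Prop :=
  v ∉ U ∧ ∃ f : (U → Bool) → Bool, ∀ w : V, w ∉ U → w ≠ v →
    (G.Adj v w ↔ f (fun u => decide (G.Adj w u.1)) = true)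

/-- The functionality of a vertex: least size of a set of which it is a function. -/
noncomputable def SimpleGraph.vertexFun {V : Type*} (G : SimpleGraph V) (v : V) : ℕ :=
  sInf {k | ∃ U : Finset V, U.card = k ∧ G.IsFunctionOf v U}

/-- The functionality of a graph. -/
noncomputable def SimpleGraph.graphFun {V : Type*} (G : SimpleGraph V) : ℕ :=
  sSup {m | ∃ W : Set V, W.Nonempty ∧
    m = sInf {k | ∃ v : W, k = (G.induce W).vertexFun v}}

/-- The symmetric difference of a pair of distinct vertices. -/
noncomputable def SimpleGraph.sdPair {V : Type*} (G : SimpleGraph V) (u v : V) : ℕ :=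
  {w | w ≠ u ∧ w ≠ v ∧ ((G.Adj w u ∧ ¬ G.Adj w v) ∨ (¬ G.Adj w u ∧ G.Adj w v))}.ncard

/-- The symmetric difference of a graph. -/
noncomputable def SimpleGraph.sdGraph {V : Type*} (G : SimpleGraph V) : ℕ :=
  sSup {m | ∃ W : Set V, (∃ u v : W, u ≠ v) ∧
    m = sInf {k | ∃ u v : W, u ≠ v ∧ k = (G.induce W).sdPair u v}}


open MeasureTheory

/-- Index set of potential edges of a graph on `Fin n`: non-diagonal unordered pairs. -/
def EdgeIdx (n : ℕ) : Type := {e : Sym2 (Fin n) // ¬ e.IsDiag}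

instance (n : ℕ) : Fintype (EdgeIdx n) := by unfold EdgeIdx; infer_instance

/-- The Bernoulli measure on `Bool` with parameter `p`. -/
noncomputable def bernoulliBool (p : ℝ) : Measure Bool :=
  ENNReal.ofReal p • Measure.dirac true + ENNReal.ofReal (1 - p) • Measure.dirac false

/-- The Erdős–Rényi measure `μ_{n,p}`: the product over all potential edges of
independent Bernoulli(`p`) coordinates. -/
noncomputable def erdosRenyiMeasure (n : ℕ) (p : ℝ) : Measure (EdgeIdx n → Bool) :=
  Measure.pi fun _ => bernoulliBool p

/-- The simple graph on `Fin n` determined by a sample `ω`. -/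
def graphOf (n : ℕ) (ω : EdgeIdx n → Bool) : SimpleGraph (Fin n) :=
  SimpleGraph.fromEdgeSet {e : Sym2 (Fin n) | ∃ h : ¬ e.IsDiag, ω ⟨e, h⟩ = true}

section Functionality

variable {V : Type*}

lemma SimpleGraph.isFunctionOf_univ_erase [Fintype V] [DecidableEq V] (G : SimpleGraph V) (v : V) :
    G.IsFunctionOf v (Finset.univ.erase v) := by
  refine ⟨by simp, fun _ => true, fun w hw hv => ?_⟩
  simp [hv] at hw

lemma SimpleGraph.exists_isFunctionOf_card_eq_vertexFun [Fintype V] (G : SimpleGraph V) (v : V) :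
    ∃ U : Finset V, U.card = G.vertexFun v ∧ G.IsFunctionOf v U := by
  classical
  exact Nat.sInf_mem (s := {k | ∃ U : Finset V, U.card = k ∧ G.IsFunctionOf v U})
    ⟨_, _, rfl, G.isFunctionOf_univ_erase v⟩

lemma SimpleGraph.vertexFun_le_card [Fintype V] (G : SimpleGraph V) (v : V) :
    G.vertexFun v ≤ Fintype.card V := by
  obtain ⟨U, hU, -⟩ := G.exists_isFunctionOf_card_eq_vertexFun v
  exact hU ▸ Finset.card_le_univ U

lemma SimpleGraph.IsFunctionOf.of_induce_univ {G : SimpleGraph V} {v : (Set.univ : Set V)}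
    {U : Finset (Set.univ : Set V)} (h : (G.induce Set.univ).IsFunctionOf v U) :
    G.IsFunctionOf v (U.map (Function.Embedding.subtype _)) := by
  obtain ⟨hv, f, hf⟩ := h
  refine ⟨by simpa using hv, fun g => f fun u => g ⟨u.1.1, by simp⟩, fun w hw hwv => ?_⟩
  exact hf ⟨w, trivial⟩ (by simpa using hw) (fun h => hwv (congrArg Subtype.val h))

/-- Some vertex is a function of a set of at most `G.graphFun` vertices. -/
lemma SimpleGraph.exists_isFunctionOf_card_le_graphFun [Fintype V] [Nonempty V]
    (G : SimpleGraph V) :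
    ∃ (v : V) (U : Finset V), U.card ≤ G.graphFun ∧ G.IsFunctionOf v U := by
  classical
  obtain ⟨v, hv⟩ : ∃ v : (Set.univ : Set V),
      sInf {k | ∃ v : (Set.univ : Set V), k = (G.induce Set.univ).vertexFun v} =
        (G.induce Set.univ).vertexFun v :=
    Nat.sInf_mem (s := {k | ∃ v : (Set.univ : Set V), k = (G.induce Set.univ).vertexFun v})
      ⟨_, ⟨Classical.arbitrary V, trivial⟩, rfl⟩
  obtain ⟨U, hU, hf⟩ := (G.induce Set.univ).exists_isFunctionOf_card_eq_vertexFun v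
  refine ⟨v, _, ?_, hf.of_induce_univ⟩
  rw [Finset.card_map, hU, ← hv]
  refine le_csSup ⟨Fintype.card V, ?_⟩ ⟨Set.univ, Set.univ_nonempty, rfl⟩
  rintro m ⟨W, ⟨w, hw⟩, rfl⟩
  calc sInf {k | ∃ v : W, k = (G.induce W).vertexFun v}
      ≤ (G.induce W).vertexFun ⟨w, hw⟩ := Nat.sInf_le ⟨_, rfl⟩
    _ ≤ Fintype.card W := SimpleGraph.vertexFun_le_card _ _
    _ ≤ Fintype.card V := Fintype.card_subtype_le _

end Functionality

section ProductMeasure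

variable {ι : Type*} [Fintype ι] {α : Type*} [MeasurableSpace α]

open Classical in
lemma measurePreserving_piecewise (ν : Measure α) [IsProbabilityMeasure ν] (A : Set ι) :
    MeasurePreserving (fun x : (ι → α) × (ι → α) => A.piecewise x.1 x.2)
      ((Measure.pi fun _ => ν).prod (Measure.pi fun _ => ν)) (Measure.pi fun _ => ν) := by
  have hm : Measurable (fun x : (ι → α) × (ι → α) => A.piecewise x.1 x.2) := by
    refine measurable_pi_lambda _ fun i => ?_
    by_cases hi : i ∈ A
    · simpa [Set.piecewise, hi, Function.comp_def] using (measurable_pi_apply i).comp measurable_fst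
    · simpa [Set.piecewise, hi, Function.comp_def] using (measurable_pi_apply i).comp measurable_snd
  refine ⟨hm, (Measure.pi_eq fun s hs => ?_).symm⟩
  rw [Measure.map_apply hm (MeasurableSet.univ_pi hs)]
  have : (fun x : (ι → α) × (ι → α) => A.piecewise x.1 x.2) ⁻¹' Set.univ.pi s =
      (Set.univ.pi fun i => if i ∈ A then s i else Set.univ) ×ˢ
        (Set.univ.pi fun i => if i ∈ A then Set.univ else s i) := by
    ext x
    simp only [Set.mem_preimage, Set.mem_pi, Set.mem_univ, true_imp_iff, Set.mem_prod,
      ← forall_and]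
    refine forall_congr' fun i => ?_
    by_cases hi : i ∈ A <;> simp [hi]
  rw [this, Measure.prod_prod, Measure.pi_pi, Measure.pi_pi, ← Finset.prod_mul_distrib]
  refine Finset.prod_congr rfl fun i _ => ?_
  by_cases hi : i ∈ A <;> simp [hi]

open Classical in
/-- To bound the measure of `S`, it suffices to do so after fixing the coordinates off `A`. -/
lemma pi_measure_le_of_forall_piecewise (ν : Measure α) [IsProbabilityMeasure ν] (A : Set ι)
    {S : Set (ι → α)} (hS : MeasurableSet S) {c : ENNReal}
    (h : ∀ y : ι → α, (Measure.pi fun _ => ν) {x | A.piecewise x y ∈ S} ≤ c) :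
    (Measure.pi fun _ => ν) S ≤ c := by
  have hp := measurePreserving_piecewise ν A
  rw [← hp.measure_preimage hS.nullMeasurableSet, Measure.prod_apply_symm (hp.measurable hS)]
  calc _ ≤ ∫⁻ _ : ι → α, c ∂(Measure.pi fun _ => ν) := lintegral_mono fun y => h y
    _ = c := by simp

lemma pi_measure_forall_eq_le (ν : Measure α) [IsProbabilityMeasure ν] {s : ENNReal}
    (hs : ∀ a, ν {a} ≤ s) {κ : Type*} [Fintype κ] {g : κ → ι} (hg : Function.Injective g)
    (z : κ → α) :
    (Measure.pi fun _ => ν) {x : ι → α | ∀ j, x (g j) = z j} ≤ s ^ Fintype.card κ := by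
  classical
  have : {x : ι → α | ∀ j, x (g j) = z j} =
      Set.univ.pi fun i => {a | ∀ j, g j = i → a = z j} := by
    ext x
    simp only [Set.mem_ofPred_eq, Set.mem_pi, Set.mem_univ, true_imp_iff]
    exact ⟨fun h i j hj => hj ▸ h j, fun h j => h _ j rfl⟩
  rw [this, Measure.pi_pi, ← Finset.prod_mul_prod_compl (Finset.univ.image g)]
  calc _ ≤ (∏ i ∈ Finset.univ.image g, s) * ∏ i ∈ (Finset.univ.image g)ᶜ, 1 := by
        gcongr with i hi
        · obtain ⟨j, -, rfl⟩ := Finset.mem_image.1 hi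
          exact (measure_mono fun a (ha : ∀ j', g j' = g j → a = z j') => ha j rfl).trans (hs (z j))
        · exact prob_le_one
    _ = s ^ Fintype.card κ := by
        rw [Finset.prod_const, Finset.prod_const_one, mul_one,
          Finset.card_image_of_injective _ hg, Finset.card_univ]

end ProductMeasure

section RandomGraph

variable {n : ℕ}

lemma isProbabilityMeasure_bernoulliBool {p : ℝ} (h0 : 0 ≤ p) (h1 : p ≤ 1) :
    IsProbabilityMeasure (bernoulliBool p) := by
  constructor
  simp only [bernoulliBool, Measure.add_apply, Measure.smul_apply, measure_univ, smul_eq_mul,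
    mul_one]
  rw [← ENNReal.ofReal_add h0 (by linarith)]
  simp

lemma bernoulliBool_singleton_le {p t : ℝ} (h0 : t ≤ p) (h1 : p ≤ 1 - t) (b : Bool) :
    bernoulliBool p {b} ≤ ENNReal.ofReal (1 - t) := by
  cases b
  · simpa [bernoulliBool] using ENNReal.ofReal_le_ofReal (show 1 - p ≤ 1 - t by linarith)
  · simpa [bernoulliBool] using ENNReal.ofReal_le_ofReal h1

/-- The index of the potential edge between two distinct vertices. -/
def edgeIdx {v w : Fin n} (h : v ≠ w) : EdgeIdx n := ⟨s(v, w), h⟩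

lemma graphOf_adj {ω : EdgeIdx n → Bool} {v w : Fin n} (h : v ≠ w) :
    (graphOf n ω).Adj v w ↔ ω (edgeIdx h) = true := by
  simp only [graphOf, SimpleGraph.fromEdgeSet_adj, Set.mem_ofPred_eq]
  exact ⟨fun ⟨⟨_, h2⟩, _⟩ => h2, fun h2 => ⟨⟨h, h2⟩, h⟩⟩

lemma edgeIdx_injective (v : Fin n) {s : Set (Fin n)} (hs : ∀ w ∈ s, v ≠ w) :
    Function.Injective fun w : s => edgeIdx (hs w.1 w.2) := by
  rintro ⟨a, ha⟩ ⟨b, hb⟩ h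
  have : s(v, a) = s(v, b) := congrArg Subtype.val h
  exact Subtype.ext (Sym2.congr_right.1 this)

instance : MeasurableSingletonClass (EdgeIdx n → Bool) := Pi.instMeasurableSingletonClass

lemma measurableSet_edgeIdx (S : Set (EdgeIdx n → Bool)) : MeasurableSet S :=
  S.toFinite.measurableSet

/-- A fixed vertex is a function of a fixed set with exponentially small probability. -/
lemma erdosRenyiMeasure_isFunctionOf_le {p t : ℝ} (ht : 0 ≤ t) (h0 : t ≤ p) (h1 : p ≤ 1 - t)
    (v : Fin n) (U : Finset (Fin n)) :
    erdosRenyiMeasure n p {ω | (graphOf n ω).IsFunctionOf v U} ≤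
      ENNReal.ofReal (1 - t) ^ (n - (U.card + 1 + 2 ^ U.card)) := by
  classical
  have : IsProbabilityMeasure (bernoulliBool p) :=
    isProbabilityMeasure_bernoulliBool (by linarith) (by linarith)
  by_cases hvU : v ∈ U
  · have : {ω | (graphOf n ω).IsFunctionOf v U} = ∅ := by
      ext ω; simp [SimpleGraph.IsFunctionOf, hvU]
    simp [this]
  set W : Finset (Fin n) := (insert v U)ᶜ with hW
  have hWv : ∀ w ∈ W, v ≠ w := by
    rintro w hw rfl; simp [hW] at hw
  have hWU : ∀ w ∈ W, w ∉ U := by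
    intro w hw hU; simp [hW, hU] at hw
  have hWcard : W.card = n - (U.card + 1) := by
    rw [hW, Finset.card_compl, Finset.card_insert_of_notMem hvU, Fintype.card_fin]
  obtain ⟨A, hA⟩ : ∃ A : Set (EdgeIdx n), ∀ e, e ∈ A ↔ ∃ w, ∃ h : w ∈ W, e = edgeIdx (hWv w h) :=
    ⟨{e | _}, fun _ => Iff.rfl⟩
  refine pi_measure_le_of_forall_piecewise _ A (measurableSet_edgeIdx _) fun y => ?_
  let pat : Fin n → U → Bool := fun w u => decide ((graphOf n y).Adj w u)
  obtain ⟨R, hRW, hRinj, hRimg⟩ := Finset.exists_subset_injOn_image_eq_of_surjOn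
    (f := pat) W (W.image pat) (by simpa using Set.surjOn_image pat W)
  have hRcard : R.card ≤ 2 ^ U.card := by
    rw [← Finset.card_image_of_injOn hRinj]
    simpa using Finset.card_le_univ (R.image pat)
  have hrep : ∀ w ∈ W, ∃ r ∈ R, pat r = pat w := fun w hw =>
    Finset.mem_image.1 (hRimg ▸ Finset.mem_image_of_mem pat hw)
  choose! r hrR hr using hrep
  have hv' : ∀ w ∈ ((W \ R : Finset (Fin n)) : Set (Fin n)), v ≠ w := fun w hw =>
    hWv w (Finset.mem_sdiff.1 hw).1
  obtain ⟨A', hA'⟩ : ∃ A' : Set (EdgeIdx n), ∀ e, e ∈ A' ↔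
      ∃ w, ∃ h : w ∈ ((W \ R : Finset (Fin n)) : Set (Fin n)), e = edgeIdx (hv' w h) :=
    ⟨{e | _}, fun _ => Iff.rfl⟩
  have hpatA : ∀ x : EdgeIdx n → Bool, ∀ w ∈ W, ∀ u : U,
      decide ((graphOf n (A.piecewise x y)).Adj w u) = pat w u := by
    intro x w hw u
    have hwu : w ≠ u := fun h => hWU w hw (h ▸ u.2)
    simp only [pat, graphOf_adj hwu]
    rw [Set.piecewise_eq_of_notMem]
    rw [hA]
    rintro ⟨w', hw', he⟩
    have he : s(w, (u : Fin n)) = s(v, w') := congrArg Subtype.val he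
    rcases Sym2.eq_iff.1 he with ⟨h, -⟩ | ⟨-, h⟩
    · exact hWv w hw h.symm
    · exact hvU (h ▸ u.2)
  have hkey : ∀ x : EdgeIdx n → Bool, (graphOf n (A.piecewise x y)).IsFunctionOf v U →
      ∀ w (hw : w ∈ W), x (edgeIdx (hWv w hw)) =
        x (edgeIdx (hWv (r w) (hRW (hrR w hw)))) := by
    rintro x ⟨-, f, hf⟩ w hw
    have hval : ∀ w (hw : w ∈ W), x (edgeIdx (hWv w hw)) = f (pat w) := by
      intro w hw
      have := hf w (hWU w hw) (hWv w hw).symm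
      rw [graphOf_adj (hWv w hw), Set.piecewise_eq_of_mem _ _ _
        ((hA _).2 ⟨w, hw, rfl⟩)] at this
      rw [Bool.eq_iff_iff, this]
      have hp : (fun u : U => decide ((graphOf n (A.piecewise x y)).Adj w u)) = pat w :=
        funext fun u => hpatA x w hw u
      rw [← hp]
    rw [hval w hw, hval (r w) (hRW (hrR w hw)), hr w hw]
  refine pi_measure_le_of_forall_piecewise _ A' (measurableSet_edgeIdx _) fun z => ?_
  have hzr : ∀ w ∈ ((W \ R : Finset (Fin n)) : Set (Fin n)), w ∈ W := fun w hw =>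
    (Finset.mem_sdiff.1 hw).1
  refine (measure_mono ?_).trans <| (pi_measure_forall_eq_le _
    (bernoulliBool_singleton_le h0 h1) (edgeIdx_injective v hv')
    (fun w => z (edgeIdx (hWv (r w) (hRW (hrR w.1 (hzr w.1 w.2))))))).trans ?_
  · rintro x hx ⟨w, hw⟩
    simp only [Set.mem_ofPred_eq] at hx
    have h := hkey _ hx w (hzr w hw)
    rw [Set.piecewise_eq_of_mem _ _ _ ((hA' _).2 ⟨w, hw, rfl⟩), Set.piecewise_eq_of_notMem] at h
    · exact h
    · rw [hA']
      rintro ⟨w', hw', he⟩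
      have he : s(v, r w) = s(v, w') := congrArg Subtype.val he
      have he : r w = w' := Sym2.congr_right.1 he
      exact (Finset.mem_sdiff.1 hw').2 (he ▸ hrR w (hzr w hw))
  · refine pow_le_pow_right_of_le_one' (by simpa using ht) ?_
    have h1 := Finset.le_card_sdiff R W
    have h2 : Fintype.card ((W \ R : Finset (Fin n)) : Set (Fin n)) = (W \ R).card :=
      Fintype.card_coe _
    rw [h2]
    omega

/-- There are at most `n ^ (k + 1)` sets of at most `k` elements of an `n`-element type. -/
lemma card_filter_card_le {k : ℕ} (hk : k + 1 ≤ n) :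
    (Finset.univ.filter fun U : Finset (Fin n) => U.card ≤ k).card ≤ n ^ (k + 1) := by
  classical
  calc (Finset.univ.filter fun U : Finset (Fin n) => U.card ≤ k).card
      ≤ ((Finset.range (k + 1)).biUnion fun j => Finset.univ.powersetCard j).card := by
        refine Finset.card_le_card fun U hU => ?_
        simpa [Nat.lt_succ_iff] using hU
    _ ≤ (Finset.range (k + 1)).card * n ^ k := by
        refine Finset.card_biUnion_le_card_mul _ _ _ fun j hj => ?_
        rw [Finset.card_powersetCard, Finset.card_univ, Fintype.card_fin]
        exact (Nat.choose_le_pow n j).trans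
          (Nat.pow_le_pow_right (by omega) (Nat.lt_succ_iff.1 (Finset.mem_range.1 hj)))
    _ ≤ n ^ (k + 1) := by
        rw [Finset.card_range, pow_succ']
        exact Nat.mul_le_mul_right _ hk

lemma union_bound_estimate {n k : ℕ} {L : ℝ} (hL : L = Real.logb 2 n) (hn : 16 ≤ n)
    (hk : (k : ℝ) ≤ L / 2) {m : ℕ} (hm : (n : ℝ) / 2 ≤ m) (ht : 3 * L ^ 2 / n ≤ 1) :
    (n : ℝ) * n ^ (k + 1) * (1 - 3 * L ^ 2 / n) ^ m ≤ (n : ℝ) ^ (-L) := by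
  have hn' : (16 : ℝ) ≤ n := by exact_mod_cast hn
  have hn0 : (0 : ℝ) < n := by linarith
  have hlog : Real.log n = L * Real.log 2 := by
    rw [hL, Real.logb, div_mul_cancel₀ _ (Real.log_pos one_lt_two).ne']
  have hL4 : 4 ≤ L := by
    rw [hL, Real.le_logb_iff_rpow_le one_lt_two hn0]
    norm_num
    exact hn
  have h2 := Real.log_two_lt_d9
  have h2' := Real.log_pos one_lt_two
  have hpow : (1 - 3 * L ^ 2 / n) ^ m ≤ Real.exp (-(3 / 2 * L ^ 2)) := by
    calc (1 - 3 * L ^ 2 / n) ^ m ≤ Real.exp (-(3 * L ^ 2 / n)) ^ m :=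
          pow_le_pow_left₀ (by linarith) (Real.one_sub_le_exp_neg _) m
      _ = Real.exp (m * -(3 * L ^ 2 / n)) := (Real.exp_nat_mul _ _).symm
      _ ≤ Real.exp (-(3 / 2 * L ^ 2)) := by
          refine Real.exp_le_exp.2 ?_
          have : (n : ℝ) / 2 * (3 * L ^ 2 / n) ≤ m * (3 * L ^ 2 / n) := by gcongr
          have h : (n : ℝ) / 2 * (3 * L ^ 2 / n) = 3 / 2 * L ^ 2 := by field_simp
          linarith
  have hcount : (n : ℝ) * n ^ (k + 1) ≤ Real.exp ((L / 2 + 2) * (L * Real.log 2)) := by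
    rw [← pow_succ', ← Real.exp_log (pow_pos hn0 _), Real.log_pow, hlog]
    refine Real.exp_le_exp.2 ?_
    push_cast
    exact mul_le_mul_of_nonneg_right (by linarith) (by positivity)
  calc (n : ℝ) * n ^ (k + 1) * (1 - 3 * L ^ 2 / n) ^ m
      ≤ Real.exp ((L / 2 + 2) * (L * Real.log 2)) * Real.exp (-(3 / 2 * L ^ 2)) :=
        mul_le_mul hcount hpow (pow_nonneg (by linarith) _) (Real.exp_pos _).le
    _ ≤ Real.exp (L * Real.log 2 * -L) := by
        rw [← Real.exp_add]
        refine Real.exp_le_exp.2 ?_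
        have : (3 / 2 * L ^ 2 + 2 * L) * Real.log 2 ≤ (3 / 2 * L ^ 2 + 2 * L) * 0.7 := by
          gcongr
          linarith
        nlinarith
    _ = (n : ℝ) ^ (-L) := by rw [Real.rpow_def_of_pos hn0, hlog]

lemma two_pow_add_le_half {n j : ℕ} (hn : 16 ≤ n) (hj : (j : ℝ) ≤ Real.logb 2 n / 2) :
    2 * (j + 1 + 2 ^ j) ≤ n := by
  have hn0 : (0 : ℝ) < n := by exact_mod_cast (by omega : 0 < n)
  have h1 : (2 ^ j) * 2 ^ j ≤ n := by
    have h : ((2 * j : ℕ) : ℝ) ≤ Real.logb 2 n := by push_cast; linarith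
    rw [Real.le_logb_iff_rpow_le one_lt_two hn0, Real.rpow_natCast] at h
    rw [← pow_add, ← two_mul]
    exact_mod_cast h
  have h2 : j + 1 ≤ 2 ^ j := Nat.lt_two_pow_self
  generalize 2 ^ j = x at *
  rcases le_or_gt 4 x with h | h
  · nlinarith
  · omega

end RandomGraph

open MeasureTheory in
/-- for large `n` and `3·(log₂ n)²/n ≤ p ≤ 1 − 3·(log₂ n)²/n`, the random
graph `G(n,p)` has functionality greater than `(1/2)·log₂ n` with probability at least
`1 − n^{−log₂ n}`. -/
theorem randomGraph_fun_lower_bound :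
    ∃ N : ℕ, ∀ n : ℕ, N ≤ n → ∀ p : ℝ,
      3 * (Real.logb 2 n) ^ 2 / n ≤ p → p ≤ 1 - 3 * (Real.logb 2 n) ^ 2 / n →
      ENNReal.ofReal (1 - (n : ℝ) ^ (-(Real.logb 2 n))) ≤
        erdosRenyiMeasure n p
          {ω : EdgeIdx n → Bool |
            (1 / 2 : ℝ) * Real.logb 2 n < ((graphOf n ω).graphFun : ℝ)} := by
  refine ⟨16, fun n hn p h0 h1 => ?_⟩
  set L := Real.logb 2 n with hL
  have hn0 : (0 : ℝ) < n := by exact_mod_cast (by omega : 0 < n)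
  have : Nonempty (Fin n) := ⟨⟨0, by omega⟩⟩
  have ht : 0 ≤ 3 * L ^ 2 / n := by positivity
  have : IsProbabilityMeasure (bernoulliBool p) :=
    isProbabilityMeasure_bernoulliBool (by linarith) (by linarith)
  have : IsProbabilityMeasure (erdosRenyiMeasure n p) := by
    unfold erdosRenyiMeasure; infer_instance
  have hL0 : 0 ≤ L := Real.logb_nonneg one_lt_two (by exact_mod_cast (by omega : 1 ≤ n))
  set S := {ω : EdgeIdx n → Bool | (1 / 2 : ℝ) * L < ((graphOf n ω).graphFun : ℝ)} with hS
  set k := ⌊L / 2⌋₊ with hk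
  have hkL : (k : ℝ) ≤ L / 2 := Nat.floor_le (by linarith)
  have hk2 := two_pow_add_le_half hn hkL
  set m := n - (k + 1 + 2 ^ k) with hm
  have hmn : n ≤ m * 2 := by
    have := Nat.two_pow_pos k
    rw [hm]
    omega
  set T := Finset.univ.filter fun U : Finset (Fin n) => U.card ≤ k with hT
  have hcover : Sᶜ ⊆ ⋃ v ∈ (Finset.univ : Finset (Fin n)), ⋃ U ∈ T,
      {ω | (graphOf n ω).IsFunctionOf v U} := by
    intro ω hω
    obtain ⟨v, U, hU, hf⟩ := (graphOf n ω).exists_isFunctionOf_card_le_graphFun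
    have hle : ((graphOf n ω).graphFun : ℝ) ≤ L / 2 := by
      simp only [hS, Set.mem_compl_iff, Set.mem_ofPred_eq, not_lt] at hω
      linarith
    simp only [Set.mem_iUnion]
    exact ⟨v, Finset.mem_univ v, U,
      Finset.mem_filter.2 ⟨Finset.mem_univ U, hU.trans (Nat.le_floor hle)⟩, hf⟩
  have hcompl : erdosRenyiMeasure n p Sᶜ ≤ ENNReal.ofReal ((n : ℝ) ^ (-L)) := by
    calc erdosRenyiMeasure n p Sᶜ
        ≤ ∑ v : Fin n, ∑ U ∈ T, erdosRenyiMeasure n p {ω | (graphOf n ω).IsFunctionOf v U} :=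
          (measure_mono hcover).trans <| (measure_biUnion_finset_le _ _).trans <|
            Finset.sum_le_sum fun v _ => measure_biUnion_finset_le _ _
      _ ≤ ∑ v : Fin n, ∑ U ∈ T, ENNReal.ofReal (1 - 3 * L ^ 2 / n) ^ m := by
          gcongr with v _ U hU
          refine (erdosRenyiMeasure_isFunctionOf_le ht h0 h1 v U).trans ?_
          refine pow_le_pow_right_of_le_one' (by simpa using ht) ?_
          have hUk : U.card ≤ k := (Finset.mem_filter.1 hU).2
          have : 2 ^ U.card ≤ 2 ^ k := Nat.pow_le_pow_right two_pos hUk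
          omega
      _ = ((n * T.card : ℕ) : ENNReal) * ENNReal.ofReal (1 - 3 * L ^ 2 / n) ^ m := by
          simp [mul_assoc]
      _ ≤ ((n * n ^ (k + 1) : ℕ) : ENNReal) * ENNReal.ofReal (1 - 3 * L ^ 2 / n) ^ m := by
          gcongr
          exact card_filter_card_le (by lia)
      _ = ENNReal.ofReal (n * n ^ (k + 1) * (1 - 3 * L ^ 2 / n) ^ m) := by
          rw [← ENNReal.ofReal_natCast, ← ENNReal.ofReal_pow (by linarith),
            ← ENNReal.ofReal_mul (by positivity)]
          push_cast
          rfl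
      _ ≤ ENNReal.ofReal ((n : ℝ) ^ (-L)) := by
          refine ENNReal.ofReal_le_ofReal (union_bound_estimate hL hn hkL ?_ (by linarith))
          rw [div_le_iff₀ two_pos]
          exact_mod_cast (hmn : n ≤ m * 2)
  have hSc := prob_compl_eq_one_sub (μ := erdosRenyiMeasure n p) (measurableSet_edgeIdx Sᶜ)
  rw [compl_compl] at hSc
  rw [hSc, ENNReal.ofReal_sub _ (by positivity), ENNReal.ofReal_one]
  exact tsub_le_tsub_left hcompl 1
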